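/- For every finitely supported function f : ℤ_{≥0} → ℂ (written f(q^{2k})) and every m ∈ ℤ_{≥0}: f(q^{2m}) = [h / (4π(1 − q^{2n}))] · ∫_0^{2π/h} 𝓕f(ρ) φ_ρ(q^{2m}) dρ / |c(ρ)|² (the inversion formula for the q-spherical transform). -/

import Mathlib

/-- The q²-shifted factorial `(a; q²)_m = ∏_{j=0}^{m-1} (1 − a q^{2j})`. -/
noncomputable def qpochC (q : ℝ) (a : ℂ) (m : ℕ) : ℂ :=
  ∏ j ∈ Finset.range m, (1 - a * (q : ℂ) ^ (2 * j))

/-- The infinite q²-shifted factorial `(a; q²)_∞ = ∏_{j=0}^{∞} (1 − a q^{2j})`. -/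
noncomputable def qpochCInf (q : ℝ) (a : ℂ) : ℂ :=
  ∏' j : ℕ, (1 - a * (q : ℂ) ^ (2 * j))

/-- `q^z = e^{z·ln q}` for complex `z`. -/
noncomputable def qcpow (q : ℝ) (z : ℂ) : ℂ := Complex.exp (z * Real.log q)

/-- The q-spherical function `φ_ρ(q^{2m})`. -/
noncomputable def sphPhi (q : ℝ) (n : ℕ) (ρ : ℝ) (m : ℕ) : ℂ :=
  ∑ l ∈ Finset.range (m + 1),
    qpochC q (((q : ℂ) ^ (2 * m))⁻¹) l *
      qpochC q (qcpow q ((n : ℂ) + ρ * Complex.I)) l *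
      qpochC q (qcpow q ((n : ℂ) - ρ * Complex.I)) l /
      (qpochC q ((q : ℂ) ^ (2 * n)) l * qpochC q ((q : ℂ) ^ 2) l) * (q : ℂ) ^ (2 * l)

/-- The q-spherical transform
`𝓕f(ρ) = (1 − q^{2n}) Σ_{k≥0} f(q^{2k}) φ_ρ(q^{2k}) q^{−2nk} (q^{2k+2};q²)_{n−1}`. -/
noncomputable def sphT (q : ℝ) (n : ℕ) (f : ℕ → ℂ) (ρ : ℝ) : ℂ :=
  (1 - (q : ℂ) ^ (2 * n)) *
    ∑' k : ℕ, f k * sphPhi q n ρ k * ((q : ℂ) ^ (2 * n * k))⁻¹ *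
      qpochC q ((q : ℂ) ^ (2 * k + 2)) (n - 1)

/-- The q-Harish-Chandra density
`1/|c(ρ)|² = (q^{2n};q²)_∞² (q^{2iρ};q²)_∞ (q^{−2iρ};q²)_∞
  / [(q^{n+iρ};q²)_∞² (q^{n−iρ};q²)_∞²]`. -/
noncomputable def cInv (q : ℝ) (n : ℕ) (ρ : ℝ) : ℂ :=
  (qpochCInf q ((q : ℂ) ^ (2 * n))) ^ 2 *
    qpochCInf q (qcpow q (2 * ρ * Complex.I)) *
    qpochCInf q (qcpow q (-(2 * ρ * Complex.I))) /
    ((qpochCInf q (qcpow q ((n : ℂ) + ρ * Complex.I))) ^ 2 *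
      (qpochCInf q (qcpow q ((n : ℂ) - ρ * Complex.I))) ^ 2)

open Filter Topology Real

section QPochhammer

variable {q : ℝ}

lemma norm_ofReal_sq_lt_one (hq0 : 0 < q) (hq1 : q < 1) : ‖(q : ℂ) ^ 2‖ < 1 := by
  rw [norm_pow, Complex.norm_real, Real.norm_of_nonneg hq0.le]
  exact pow_lt_one₀ hq0.le hq1 two_ne_zero

lemma summable_norm_qpoch_factor (hq0 : 0 < q) (hq1 : q < 1) (x : ℂ) :
    Summable fun j : ℕ => ‖-(x * (q : ℂ) ^ (2 * j))‖ := by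
  simp only [norm_neg, norm_mul, pow_mul, norm_pow _ (_ : ℕ)]
  refine (summable_geometric_of_lt_one (by positivity) ?_).mul_left _
  simpa using norm_ofReal_sq_lt_one hq0 hq1

lemma multipliable_qpoch_factor (hq0 : 0 < q) (hq1 : q < 1) (x : ℂ) :
    Multipliable fun j : ℕ => 1 - x * (q : ℂ) ^ (2 * j) := by
  simpa [sub_eq_add_neg] using
    multipliable_one_add_of_summable (summable_norm_qpoch_factor hq0 hq1 x)

lemma tendsto_qpochC (hq0 : 0 < q) (hq1 : q < 1) (x : ℂ) :
    Tendsto (qpochC q x) atTop (𝓝 (qpochCInf q x)) :=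
  (multipliable_qpoch_factor hq0 hq1 x).hasProd.tendsto_prod_nat

lemma qpochC_zero (x : ℂ) : qpochC q x 0 = 1 := by simp [qpochC]

lemma qpochC_succ (x : ℂ) (N : ℕ) :
    qpochC q x (N + 1) = qpochC q x N * (1 - x * (q : ℂ) ^ (2 * N)) := by
  simp [qpochC, Finset.prod_range_succ]

lemma qpochC_add (x : ℂ) (N M : ℕ) :
    qpochC q x (N + M) = qpochC q x N * qpochC q (x * (q : ℂ) ^ (2 * N)) M := by
  simp only [qpochC, Finset.prod_range_add]
  congr 1
  exact Finset.prod_congr rfl fun j _ => by ring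

lemma qpochC_succ' (x : ℂ) (N : ℕ) :
    qpochC q x (N + 1) = (1 - x) * qpochC q (x * (q : ℂ) ^ 2) N := by
  rw [add_comm, qpochC_add]
  simp [qpochC]

lemma qpochCInf_eq_qpochC_mul (hq0 : 0 < q) (hq1 : q < 1) (x : ℂ) (N : ℕ) :
    qpochCInf q x = qpochC q x N * qpochCInf q (x * (q : ℂ) ^ (2 * N)) := by
  refine tendsto_nhds_unique ((tendsto_qpochC hq0 hq1 x).comp (tendsto_add_atTop_nat N)) ?_
  refine ((tendsto_qpochC hq0 hq1 (x * (q : ℂ) ^ (2 * N))).const_mul (qpochC q x N)).congr ?_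
  intro M
  rw [Function.comp_apply, add_comm M N, qpochC_add]

lemma qpochCInf_eq_one_sub_mul (hq0 : 0 < q) (hq1 : q < 1) (x : ℂ) :
    qpochCInf q x = (1 - x) * qpochCInf q (x * (q : ℂ) ^ 2) := by
  simpa [qpochC] using qpochCInf_eq_qpochC_mul hq0 hq1 x 1

lemma one_sub_mul_pow_ne_zero (hq0 : 0 < q) (hq1 : q < 1) {x : ℂ} (hx : ‖x‖ < 1) (j : ℕ) :
    1 - x * (q : ℂ) ^ j ≠ 0 := by
  intro h
  have h1 : ‖x * (q : ℂ) ^ j‖ = 1 := by rw [← sub_eq_zero.mp h, norm_one]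
  rw [norm_mul, norm_pow, Complex.norm_real, Real.norm_of_nonneg hq0.le] at h1
  have : q ^ j ≤ 1 := pow_le_one₀ hq0.le hq1.le
  nlinarith [norm_nonneg x, pow_pos hq0 j]

lemma qpochC_ne_zero (hq0 : 0 < q) (hq1 : q < 1) {x : ℂ} (hx : ‖x‖ < 1) (N : ℕ) :
    qpochC q x N ≠ 0 :=
  Finset.prod_ne_zero_iff.mpr fun _ _ => one_sub_mul_pow_ne_zero hq0 hq1 hx _

lemma qpochCInf_ne_zero (hq0 : 0 < q) (hq1 : q < 1) {x : ℂ} (hx : ‖x‖ < 1) :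
    qpochCInf q x ≠ 0 := by
  have := tprod_one_add_ne_zero_of_summable
    (f := fun j : ℕ => -(x * (q : ℂ) ^ (2 * j)))
    (fun j => by simpa [sub_eq_add_neg] using one_sub_mul_pow_ne_zero hq0 hq1 hx (2 * j))
    (summable_norm_qpoch_factor hq0 hq1 x)
  simpa [qpochCInf, sub_eq_add_neg] using this

lemma differentiable_qpochCInf (hq0 : 0 < q) (hq1 : q < 1) :
    Differentiable ℂ (qpochCInf q) := by
  intro x₀
  have hopen : IsOpen (Metric.ball (0 : ℂ) (‖x₀‖ + 1)) := Metric.isOpen_ball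
  have h := Summable.hasProdLocallyUniformlyOn_nat_one_add
    (f := fun (j : ℕ) (x : ℂ) => -(x * (q : ℂ) ^ (2 * j))) hopen
    (summable_norm_qpoch_factor hq0 hq1 ((‖x₀‖ + 1 : ℝ) : ℂ)) (.of_forall fun j x hx => ?_)
    (fun j => by fun_prop)
  · have hd := h.differentiableOn (.of_forall fun s => by
      simpa [Finset.prod_fn] using
        DifferentiableOn.finsetProd (fun _ _ => by fun_prop)) hopen
    have := hd.differentiableAt (hopen.mem_nhds (x := x₀) (by simp))
    have e : qpochCInf q = fun x => ∏' j : ℕ, (1 + -(x * (q : ℂ) ^ (2 * j))) := by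
      simp only [funext_iff, qpochCInf, sub_eq_add_neg, implies_true]
    rw [e]
    exact this
  · simp only [norm_neg, norm_mul]
    gcongr
    rw [Complex.norm_real, Real.norm_of_nonneg (by positivity)]
    simpa using (Metric.mem_ball.mp hx).le

lemma norm_qpochC_le (hq0 : 0 < q) (hq1 : q < 1) (x : ℂ) (N : ℕ) :
    ‖qpochC q x N‖ ≤ Real.exp (‖x‖ * ∑' j : ℕ, ‖-((1 : ℂ) * (q : ℂ) ^ (2 * j))‖) := by
  have h1 : ‖qpochC q x N‖ ≤
      ∏ j ∈ Finset.range N, (1 + ‖x‖ * ‖-((1 : ℂ) * (q : ℂ) ^ (2 * j))‖) := by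
    rw [qpochC, norm_prod]
    refine Finset.prod_le_prod (fun _ _ => norm_nonneg _) fun j _ => ?_
    refine (norm_sub_le _ _).trans_eq ?_
    simp
  refine h1.trans ((Real.prod_one_add_le_exp_sum _ fun j => by positivity).trans ?_)
  rw [← Finset.mul_sum]
  gcongr
  exact (summable_norm_qpoch_factor hq0 hq1 1).sum_le_tsum _ fun _ _ => norm_nonneg _

end QPochhammer

lemma circleAverage_eq_of_differentiableAt_annulus {f : ℂ → ℂ} {r R : ℝ} (hr : 0 < r)
    (hrR : r ≤ R) (hf : ∀ z : ℂ, r ≤ ‖z‖ → ‖z‖ ≤ R → DifferentiableAt ℂ f z) :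
    circleAverage (fun z => f (r * z)) 0 1 = circleAverage (fun z => f (R * z)) 0 1 := by
  have h := Complex.circleIntegral_sub_center_inv_smul_eq_of_differentiable_on_annulus_off_countable
    (c := 0) (f := f) hr hrR Set.countable_empty
    (fun z hz => (hf z (by simpa using hz.2) (by simpa using hz.1)).continuousAt.continuousWithinAt)
    (fun z hz => hf z (by have := hz.1.2; simp at this; exact this.le)
      (by have := hz.1.1; simp at this; exact this.le))
  have key : circleAverage f 0 r = circleAverage f 0 R := by
    rw [circleAverage_eq_circleIntegral hr.ne', circleAverage_eq_circleIntegral (hr.trans_le hrR).ne',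
      h]
  rw [circleAverage_eq_circleAverage_zero_one, circleAverage_eq_circleAverage_zero_one (R := R)] at key
  simpa using key

lemma circleIntegrable_of_continuousAt {f : ℂ → ℂ} (hf : ∀ z : ℂ, ‖z‖ = 1 → ContinuousAt f z) :
    CircleIntegrable f 0 1 :=
  ContinuousOn.circleIntegrable zero_le_one fun z hz =>
    (hf z (by simpa using hz)).continuousWithinAt

/-- The weight `(z², z⁻²; q²)_∞ / (az, a/z, bz, b/z; q²)_∞` of the Al-Salam–Chihara polynomials. -/
noncomputable def ascWeight (q : ℝ) (a b z : ℂ) : ℂ :=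
  qpochCInf q (z ^ 2) * qpochCInf q ((z⁻¹) ^ 2) /
    (qpochCInf q (a * z) * qpochCInf q (a * z⁻¹) * (qpochCInf q (b * z) * qpochCInf q (b * z⁻¹)))

section Weight

variable {q : ℝ}

lemma ascWeight_comm (a b z : ℂ) : ascWeight q a b z = ascWeight q b a z := by
  rw [ascWeight, ascWeight, mul_comm (qpochCInf q (a * z) * _)]

lemma continuousAt_ascWeight (hq0 : 0 < q) (hq1 : q < 1) {a b z : ℂ} (ha : ‖a‖ < 1)
    (hb : ‖b‖ < 1) (hz : ‖z‖ = 1) : ContinuousAt (ascWeight q a b) z := by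
  have hz0 : z ≠ 0 := norm_ne_zero_iff.mp (by simp [hz])
  have hc := (differentiable_qpochCInf hq0 hq1).continuous
  have hinv : ContinuousAt (fun z : ℂ => z⁻¹) z := continuousAt_inv₀ hz0
  refine ContinuousAt.div ?_ ?_ ?_
  · exact (hc.continuousAt.comp (by fun_prop)).mul (hc.continuousAt.comp (by fun_prop))
  · exact ((hc.continuousAt.comp (by fun_prop)).mul (hc.continuousAt.comp (by fun_prop))).mul
      ((hc.continuousAt.comp (by fun_prop)).mul (hc.continuousAt.comp (by fun_prop)))
  · refine mul_ne_zero (mul_ne_zero ?_ ?_) (mul_ne_zero ?_ ?_) <;>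
      exact qpochCInf_ne_zero hq0 hq1 (by simpa [hz])

/-- A function on the annulus `q ≤ ‖z‖ ≤ q⁻¹` whose `q`-difference quotient is
`ascWeight q a b z * (z + z⁻¹ - (a + b))`. -/
noncomputable def ascPrimitive (q : ℝ) (a b z : ℂ) : ℂ :=
  qpochCInf q (z ^ 2) * qpochCInf q (q ^ 2 * (z⁻¹) ^ 2) /
    (z * (qpochCInf q (a * q * z) * qpochCInf q (a * q * z⁻¹) *
      (qpochCInf q (b * q * z) * qpochCInf q (b * q * z⁻¹))))

lemma differentiableAt_ascPrimitive (hq0 : 0 < q) (hq1 : q < 1) {a b z : ℂ} (ha : ‖a‖ < 1)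
    (hb : ‖b‖ < 1) (hz : q ≤ ‖z‖) (hz' : ‖z‖ ≤ q⁻¹) :
    DifferentiableAt ℂ (ascPrimitive q a b) z := by
  have hz0 : z ≠ 0 := norm_pos_iff.mp (hq0.trans_le hz)
  have hd := differentiable_qpochCInf hq0 hq1
  have hinv : DifferentiableAt ℂ (fun z : ℂ => z⁻¹) z := differentiableAt_inv hz0
  have h1 : ∀ c : ℂ, ‖c‖ < 1 → ‖c * q * z‖ < 1 := fun c hc => by
    rw [norm_mul, norm_mul, Complex.norm_real, Real.norm_of_nonneg hq0.le, mul_assoc]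
    have : q * ‖z‖ ≤ 1 := (mul_le_mul_of_nonneg_left hz' hq0.le).trans_eq (mul_inv_cancel₀ hq0.ne')
    nlinarith [norm_nonneg c]
  have h2 : ∀ c : ℂ, ‖c‖ < 1 → ‖c * q * z⁻¹‖ < 1 := fun c hc => by
    rw [norm_mul, norm_mul, Complex.norm_real, Real.norm_of_nonneg hq0.le, mul_assoc, norm_inv]
    have : q * ‖z‖⁻¹ ≤ 1 := by
      rw [← div_eq_mul_inv]
      exact div_le_one_of_le₀ hz (norm_nonneg z)
    nlinarith [norm_nonneg c]
  refine DifferentiableAt.fun_div ?_ ?_ ?_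
  · exact ((hd _).fun_comp' _ (by fun_prop)).mul ((hd _).fun_comp' _ (by fun_prop))
  · exact differentiableAt_id.mul
      ((((hd _).fun_comp' _ (by fun_prop)).mul ((hd _).fun_comp' _ (by fun_prop))).mul
      (((hd _).fun_comp' _ (by fun_prop)).mul ((hd _).fun_comp' _ (by fun_prop))))
  · refine mul_ne_zero hz0 (mul_ne_zero (mul_ne_zero ?_ ?_) (mul_ne_zero ?_ ?_)) <;>
      apply qpochCInf_ne_zero hq0 hq1 <;> simp only [h1, h2, ha, hb]

lemma ascPrimitive_sub (hq0 : 0 < q) (hq1 : q < 1) {a b z : ℂ} (ha : ‖a‖ < 1)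
    (hb : ‖b‖ < 1) (hz : ‖z‖ = 1) :
    ascWeight q a b z * (z + z⁻¹ - (a + b)) =
      q * (ascPrimitive q a b (q * z) - ascPrimitive q a b ((q⁻¹ : ℝ) * z)) := by
  have hz0 : z ≠ 0 := norm_ne_zero_iff.mp (by simp [hz])
  have hqc : (q : ℂ) ≠ 0 := by exact_mod_cast hq0.ne'
  have hX : qpochCInf q (z ^ 2) = (1 - z ^ 2) * qpochCInf q (z ^ 2 * q ^ 2) :=
    qpochCInf_eq_one_sub_mul hq0 hq1 _
  have hX' : qpochCInf q (z ^ 2 * ((q : ℂ)⁻¹) ^ 2) =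
      (1 - z ^ 2 * ((q : ℂ)⁻¹) ^ 2) * ((1 - z ^ 2) * qpochCInf q (z ^ 2 * q ^ 2)) := by
    rw [qpochCInf_eq_one_sub_mul hq0 hq1, ← hX]
    congr 2
    field_simp
  have hY : qpochCInf q ((z⁻¹) ^ 2) =
      (1 - (z⁻¹) ^ 2) * ((1 - (z⁻¹) ^ 2 * q ^ 2) * qpochCInf q ((z⁻¹) ^ 2 * q ^ 2 * q ^ 2)) := by
    rw [← qpochCInf_eq_one_sub_mul hq0 hq1, ← qpochCInf_eq_one_sub_mul hq0 hq1]
  have hfac : ∀ c w : ℂ, qpochCInf q (c * w) = (1 - c * w) * qpochCInf q (c * w * q ^ 2) :=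
    fun c w => qpochCInf_eq_one_sub_mul hq0 hq1 _
  have hne : ∀ c w : ℂ, ‖c‖ < 1 → ‖w‖ = 1 → qpochCInf q (c * w * q ^ 2) ≠ 0 ∧ 1 - c * w ≠ 0 := by
    intro c w hc hw
    have h : qpochCInf q (c * w) ≠ 0 := qpochCInf_ne_zero hq0 hq1 (by simpa [hw])
    rw [hfac] at h
    exact ⟨right_ne_zero_of_mul h, left_ne_zero_of_mul h⟩
  have hz' : ‖z⁻¹‖ = 1 := by simp [hz]
  obtain ⟨a1, a2⟩ := hne a z ha hz
  obtain ⟨a3, a4⟩ := hne a z⁻¹ ha hz'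
  obtain ⟨b1, b2⟩ := hne b z hb hz
  obtain ⟨b3, b4⟩ := hne b z⁻¹ hb hz'
  have e1 : ∀ c : ℂ, c * q * (q * z) = c * z * q ^ 2 := fun c => by ring
  have e2 : ∀ c : ℂ, c * q * (q * z)⁻¹ = c * z⁻¹ := fun c => by field_simp
  have e3 : ∀ c : ℂ, c * q * ((q⁻¹ : ℝ) * z) = c * z := fun c => by push_cast; field_simp
  have e4 : ∀ c : ℂ, c * q * ((q⁻¹ : ℝ) * z)⁻¹ = c * z⁻¹ * q ^ 2 := fun c => by
    push_cast; field_simp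
  have e5 : (q * z : ℂ) ^ 2 = z ^ 2 * q ^ 2 := by ring
  have e6 : (q : ℂ) ^ 2 * (q * z : ℂ)⁻¹ ^ 2 = (z⁻¹) ^ 2 := by field_simp
  have e7 : ((q⁻¹ : ℝ) * z : ℂ) ^ 2 = z ^ 2 * ((q : ℂ)⁻¹) ^ 2 := by push_cast; ring
  have e8 : (q : ℂ) ^ 2 * ((q⁻¹ : ℝ) * z : ℂ)⁻¹ ^ 2 = (z⁻¹) ^ 2 * q ^ 2 * q ^ 2 := by
    push_cast; field_simp
  simp only [ascPrimitive, ascWeight, e1, e2, e3, e4, e5, e6, e7, e8]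
  rw [hX, hX', hY, hfac a z, hfac a z⁻¹, hfac b z, hfac b z⁻¹]
  push_cast
  generalize qpochCInf q (z ^ 2 * q ^ 2) = X
  generalize qpochCInf q ((z⁻¹) ^ 2 * q ^ 2 * q ^ 2) = Y
  generalize qpochCInf q (a * z * q ^ 2) = A at *
  generalize qpochCInf q (a * z⁻¹ * q ^ 2) = A' at *
  generalize qpochCInf q (b * z * q ^ 2) = B at *
  generalize qpochCInf q (b * z⁻¹ * q ^ 2) = B' at *
  have a5 : z - a ≠ 0 := fun h => a4 (by rw [← sub_eq_zero.mp h]; simp [hz0])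
  have b5 : z - b ≠ 0 := fun h => b4 (by rw [← sub_eq_zero.mp h]; simp [hz0])
  rw [mul_comm a z] at a2
  rw [mul_comm b z] at b2
  rw [mul_comm a z, mul_comm b z]
  field_simp
  ring

lemma circleAverage_ascWeight_mul (hq0 : 0 < q) (hq1 : q < 1) {a b : ℂ} (ha : ‖a‖ < 1)
    (hb : ‖b‖ < 1) :
    circleAverage (fun z => ascWeight q a b z * (z + z⁻¹ - (a + b))) 0 1 = 0 := by
  have hqi : q ≤ q⁻¹ := hq1.le.trans ((one_le_inv₀ hq0).mpr hq1.le)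
  have hint : ∀ r : ℝ, q ≤ r → r ≤ q⁻¹ →
      CircleIntegrable (fun z => ascPrimitive q a b (r * z)) 0 1 := fun r h1 h2 =>
    circleIntegrable_of_continuousAt fun z hz => by
      have hn : ‖(r : ℂ) * z‖ = r := by simp [hz, (hq0.trans_le h1).le]
      exact ContinuousAt.comp' (differentiableAt_ascPrimitive hq0 hq1 ha hb (by rwa [hn])
        (by rwa [hn])).continuousAt (by fun_prop)
  rw [circleAverage_congr_sphere (f₂ := fun z => (q : ℂ) • (ascPrimitive q a b (q * z) -
    ascPrimitive q a b ((q⁻¹ : ℝ) * z))) fun z hz =>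
      ascPrimitive_sub hq0 hq1 ha hb (by simpa using hz), circleAverage_fun_smul,
    circleAverage_fun_sub (hint q le_rfl hqi) (hint q⁻¹ hqi le_rfl),
    circleAverage_eq_of_differentiableAt_annulus hq0 hqi fun z h1 h2 =>
      differentiableAt_ascPrimitive hq0 hq1 ha hb h1 h2, sub_self, smul_zero]

lemma ascWeight_mul_qpochC (hq0 : 0 < q) (hq1 : q < 1) {a b z : ℂ} (ha : ‖a‖ < 1)
    (hz : ‖z‖ = 1) (N : ℕ) :
    ascWeight q (a * q ^ (2 * N)) b z =
      qpochC q (a * z) N * qpochC q (a * z⁻¹) N * ascWeight q a b z := by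
  have h1 : qpochC q (a * z) N ≠ 0 := qpochC_ne_zero hq0 hq1 (by simpa [hz]) N
  have h2 : qpochC q (a * z⁻¹) N ≠ 0 := qpochC_ne_zero hq0 hq1 (by simpa [hz]) N
  have e : ∀ w : ℂ, a * q ^ (2 * N) * w = a * w * q ^ (2 * N) := fun w => by ring
  rw [ascWeight, ascWeight, qpochCInf_eq_qpochC_mul hq0 hq1 (a * z) N,
    qpochCInf_eq_qpochC_mul hq0 hq1 (a * z⁻¹) N, e, e]
  generalize qpochC q (a * z) N = A at *
  generalize qpochC q (a * z⁻¹) N = A' at *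
  generalize qpochCInf q (z ^ 2) * qpochCInf q (z⁻¹ ^ 2) = X
  rw [mul_mul_mul_comm A, mul_assoc (A * A'), ← mul_div_assoc, mul_div_mul_left _ _
    (mul_ne_zero h1 h2)]

lemma circleAverage_ascWeight_shift (hq0 : 0 < q) (hq1 : q < 1) {a b : ℂ} (ha : ‖a‖ < 1)
    (hb : ‖b‖ < 1) :
    circleAverage (ascWeight q (a * q ^ 2) b) 0 1 =
      (1 - a * b) * circleAverage (ascWeight q a b) 0 1 := by
  have hw := fun z hz => continuousAt_ascWeight (z := z) hq0 hq1 ha hb hz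
  have hint : CircleIntegrable (fun z => ascWeight q a b z * (z + z⁻¹ - (a + b))) 0 1 :=
    circleIntegrable_of_continuousAt fun z hz => by
      have hz0 : z ≠ 0 := norm_ne_zero_iff.mp (by simp [hz])
      have hinv : ContinuousAt (fun z : ℂ => z⁻¹) z := continuousAt_inv₀ hz0
      exact (hw z hz).mul (by fun_prop)
  rw [circleAverage_congr_sphere (f₂ := fun z => (1 - a * b) • ascWeight q a b z -
    a • (ascWeight q a b z * (z + z⁻¹ - (a + b)))), circleAverage_fun_sub, circleAverage_fun_smul,
    circleAverage_fun_smul, circleAverage_ascWeight_mul hq0 hq1 ha hb]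
  · simp
  · exact (circleIntegrable_of_continuousAt hw).const_smul
  · exact hint.const_smul
  · intro z hz
    replace hz : ‖z‖ = 1 := by simpa using hz
    have hz0 : z ≠ 0 := norm_ne_zero_iff.mp (by simp [hz])
    have := ascWeight_mul_qpochC (b := b) hq0 hq1 ha hz 1
    simp only [mul_one] at this
    simp only [this, qpochC, Finset.prod_range_one, smul_eq_mul]
    field_simp
    ring

lemma norm_mul_pow_lt_one (hq0 : 0 < q) (hq1 : q < 1) {a : ℂ} (ha : ‖a‖ < 1) (N : ℕ) :
    ‖a * (q : ℂ) ^ N‖ < 1 := by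
  rw [norm_mul, norm_pow, Complex.norm_real, Real.norm_of_nonneg hq0.le]
  exact mul_lt_one_of_nonneg_of_lt_one_left (norm_nonneg a) ha (pow_le_one₀ hq0.le hq1.le)

lemma circleAverage_ascWeight_shift_left (hq0 : 0 < q) (hq1 : q < 1) {a b : ℂ} (ha : ‖a‖ < 1)
    (hb : ‖b‖ < 1) (N : ℕ) :
    circleAverage (ascWeight q (a * q ^ (2 * N)) b) 0 1 =
      qpochC q (a * b) N * circleAverage (ascWeight q a b) 0 1 := by
  induction N with
  | zero => simp [qpochC_zero]
  | succ N ih =>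
    have e : a * (q : ℂ) ^ (2 * (N + 1)) = a * q ^ (2 * N) * q ^ 2 := by ring
    rw [e, circleAverage_ascWeight_shift hq0 hq1 (norm_mul_pow_lt_one hq0 hq1 ha _) hb, ih,
      qpochC_succ]
    ring

lemma circleAverage_ascWeight_shift_shift (hq0 : 0 < q) (hq1 : q < 1) {a b : ℂ} (ha : ‖a‖ < 1)
    (hb : ‖b‖ < 1) (N M : ℕ) :
    circleAverage (ascWeight q (a * q ^ (2 * N)) (b * q ^ (2 * M))) 0 1 =
      qpochC q (a * b) (N + M) * circleAverage (ascWeight q a b) 0 1 := by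
  have hcomm : ∀ a b : ℂ, ascWeight q a b = ascWeight q b a := fun a b =>
    funext fun z => ascWeight_comm a b z
  have ha' := norm_mul_pow_lt_one hq0 hq1 ha (2 * N)
  rw [hcomm, circleAverage_ascWeight_shift_left hq0 hq1 hb ha', hcomm,
    circleAverage_ascWeight_shift_left hq0 hq1 ha hb, qpochC_add,
    show b * (a * (q : ℂ) ^ (2 * N)) = a * b * q ^ (2 * N) by ring]
  ring

end Weight

lemma tendsto_circleAverage_of_dominated {F : ℕ → ℂ → ℂ} {G : ℂ → ℂ} {g : ℂ → ℝ}
    (hF : ∀ N, ∀ z : ℂ, ‖z‖ = 1 → ContinuousAt (F N) z) (hg : CircleIntegrable g 0 1)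
    (hb : ∀ N, ∀ z : ℂ, ‖z‖ = 1 → ‖F N z‖ ≤ g z)
    (hl : ∀ z : ℂ, ‖z‖ = 1 → Tendsto (fun N => F N z) atTop (𝓝 (G z))) :
    Tendsto (fun N => circleAverage (F N) 0 1) atTop (𝓝 (circleAverage G 0 1)) := by
  refine Tendsto.const_smul ?_ _
  have hn : ∀ θ, ‖circleMap 0 1 θ‖ = 1 := fun θ => by simp
  refine intervalIntegral.tendsto_integral_filter_of_dominated_convergence
    (fun θ => g (circleMap 0 1 θ)) (.of_forall fun N => ?_) (.of_forall fun N => ?_) hg ?_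
  · exact (circleIntegrable_of_continuousAt (hF N)).aestronglyMeasurable_restrict_uIoc
  · exact .of_forall fun θ _ => hb N _ (hn θ)
  · exact .of_forall fun θ _ => hl _ (hn θ)

lemma circleAverage_lincomb {f g : ℂ → ℂ} (c d : ℂ) (hf : CircleIntegrable f 0 1)
    (hg : CircleIntegrable g 0 1) :
    c * circleAverage f 0 1 - d * circleAverage g 0 1 =
      circleAverage (fun z => c * f z - d * g z) 0 1 := by
  have h := circleAverage_fun_sub (hf.const_smul (a := c)) (hg.const_smul (a := d))
  simp only [Pi.smul_apply, smul_eq_mul] at h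
  rw [h, ← smul_eq_mul c, ← smul_eq_mul d, ← circleAverage_fun_smul, ← circleAverage_fun_smul]
  rfl

section TotalMass

variable {q : ℝ}

lemma continuous_qpochC (N : ℕ) : Continuous fun x => qpochC q x N := by
  unfold qpochC
  fun_prop

lemma differentiable_qpochC (N : ℕ) : Differentiable ℂ fun x => qpochC q x N := by
  unfold qpochC
  fun_prop

lemma circleAverage_ascWeight_mul_qpochCInf (hq0 : 0 < q) (hq1 : q < 1) {a b : ℂ}
    (ha : ‖a‖ < 1) (hb : ‖b‖ < 1) :
    qpochCInf q (a * b) * circleAverage (ascWeight q a b) 0 1 =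
      circleAverage (fun z => qpochCInf q (z ^ 2) * qpochCInf q ((z⁻¹) ^ 2)) 0 1 := by
  have hL : Tendsto (fun N : ℕ => circleAverage
      (ascWeight q (a * q ^ (2 * N)) (b * q ^ (2 * N))) 0 1) atTop
      (𝓝 (qpochCInf q (a * b) * circleAverage (ascWeight q a b) 0 1)) := by
    simp only [circleAverage_ascWeight_shift_shift hq0 hq1 ha hb]
    refine ((tendsto_qpochC hq0 hq1 _).comp ?_).mul_const _
    exact tendsto_atTop_mono (fun N => Nat.le_add_left N N) tendsto_id
  refine tendsto_nhds_unique hL ?_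
  have hfac : ∀ N : ℕ, ∀ z : ℂ, ‖z‖ = 1 → ascWeight q (a * q ^ (2 * N)) (b * q ^ (2 * N)) z =
      qpochC q (a * z) N * qpochC q (a * z⁻¹) N * (qpochC q (b * z) N * qpochC q (b * z⁻¹) N *
        ascWeight q a b z) := fun N z hz => by
    rw [ascWeight_mul_qpochC hq0 hq1 ha hz, ascWeight_comm, ascWeight_mul_qpochC hq0 hq1 hb hz,
      ascWeight_comm]
  have hw := fun z hz => continuousAt_ascWeight (z := z) hq0 hq1 ha hb hz
  set S := ∑' j : ℕ, ‖-((1 : ℂ) * (q : ℂ) ^ (2 * j))‖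
  have hS : ∀ N : ℕ, ∀ c z : ℂ, ‖c‖ < 1 → ‖z‖ = 1 → ‖qpochC q (c * z) N‖ ≤ Real.exp S := by
    intro N c z hc hz
    refine (norm_qpochC_le hq0 hq1 _ N).trans (Real.exp_le_exp.mpr ?_)
    refine mul_le_of_le_one_left (tsum_nonneg fun _ => norm_nonneg _) ?_
    simpa [hz] using hc.le
  refine tendsto_circleAverage_of_dominated
    (g := fun z => Real.exp S * Real.exp S * (Real.exp S * Real.exp S * ‖ascWeight q a b z‖))
    (fun N z hz => continuousAt_ascWeight hq0 hq1 (norm_mul_pow_lt_one hq0 hq1 ha _)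
      (norm_mul_pow_lt_one hq0 hq1 hb _) hz) ?_ (fun N z hz => ?_) (fun z hz => ?_)
  · exact ((circleIntegrable_of_continuousAt hw).norm.const_mul _).const_mul _
  · have hz' : ‖z⁻¹‖ = 1 := by simp [hz]
    rw [hfac N z hz]
    simp only [norm_mul]
    have h1 := hS N a z ha hz
    have h2 := hS N a z⁻¹ ha hz'
    have h3 := hS N b z hb hz
    have h4 := hS N b z⁻¹ hb hz'
    gcongr
  · have hz' : ‖z⁻¹‖ = 1 := by simp [hz]
    have hl := ((tendsto_qpochC hq0 hq1 (a * z)).mul (tendsto_qpochC hq0 hq1 (a * z⁻¹))).mul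
      (((tendsto_qpochC hq0 hq1 (b * z)).mul (tendsto_qpochC hq0 hq1 (b * z⁻¹))).mul_const
        (ascWeight q a b z))
    have hne : ∀ c w : ℂ, ‖c‖ < 1 → ‖w‖ = 1 → qpochCInf q (c * w) ≠ 0 := fun c w hc hw =>
      qpochCInf_ne_zero hq0 hq1 (by simpa [hw])
    have h1 := hne a z ha hz
    have h2 := hne a z⁻¹ ha hz'
    have h3 := hne b z hb hz
    have h4 := hne b z⁻¹ hb hz'
    convert hl.congr fun N => (hfac N z hz).symm using 2
    rw [ascWeight, ← mul_assoc, mul_div_cancel₀]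
    exact mul_ne_zero (mul_ne_zero h1 h2) (mul_ne_zero h3 h4)

/-- The finite theta product `(w; q²)_N (q²/w; q²)_N`. -/
noncomputable def finiteTheta (q : ℝ) (N : ℕ) (w : ℂ) : ℂ :=
  qpochC q w N * qpochC q (q ^ 2 * w⁻¹) N

lemma finiteTheta_succ (N : ℕ) (w : ℂ) :
    finiteTheta q (N + 1) w =
      finiteTheta q N w * ((1 - w * q ^ (2 * N)) * (1 - q ^ 2 * w⁻¹ * q ^ (2 * N))) := by
  simp only [finiteTheta, qpochC_succ]
  ring

lemma finiteTheta_shift (hq0 : 0 < q) (N : ℕ) {w : ℂ} (hw : w ≠ 0) :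
    finiteTheta q N (q ^ 2 * w) * (q ^ (2 * N) - w) =
      finiteTheta q N w * (1 - q ^ (2 * N) * w) := by
  have hqc : (q : ℂ) ≠ 0 := by exact_mod_cast hq0.ne'
  induction N with
  | zero => simp [finiteTheta, qpochC_zero]
  | succ N ih =>
    rw [finiteTheta_succ, finiteTheta_succ, mul_add, pow_add]
    generalize (q : ℂ) ^ (2 * N) = P at *
    generalize finiteTheta q N (q ^ 2 * w) = X at *
    generalize finiteTheta q N w = Y at *
    field_simp
    linear_combination (1 - P * w * q ^ 2) * (w - P * q ^ 2) * ih

/-- The Laurent coefficient of `w^(-k)` in `finiteTheta q N w`, as an average over `w = z²`. -/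
noncomputable def thetaCoeff (q : ℝ) (N : ℕ) (k : ℤ) : ℂ :=
  circleAverage (fun z => finiteTheta q N (z ^ 2) * (z ^ 2) ^ k) 0 1

lemma differentiableAt_finiteTheta_mul_zpow (N : ℕ) (k : ℤ) {z : ℂ} (hz : z ≠ 0) :
    DifferentiableAt ℂ (fun z => finiteTheta q N (z ^ 2) * (z ^ 2) ^ k) z := by
  have hd := differentiable_qpochC (q := q) N
  have hz2 : z ^ 2 ≠ 0 := pow_ne_zero 2 hz
  have hinv : DifferentiableAt ℂ (fun z : ℂ => (z ^ 2)⁻¹) z :=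
    DifferentiableAt.fun_inv (by fun_prop) hz2
  refine DifferentiableAt.mul (DifferentiableAt.mul ?_ ?_) ?_
  · exact (hd _).fun_comp' _ (by fun_prop)
  · exact (hd _).fun_comp' _ (by fun_prop)
  · exact DifferentiableAt.zpow (by fun_prop) (Or.inl hz2)

lemma circleIntegrable_finiteTheta (N : ℕ) (k : ℤ) :
    CircleIntegrable (fun z => finiteTheta q N (z ^ 2) * (z ^ 2) ^ k) 0 1 :=
  circleIntegrable_of_continuousAt fun z hz =>
    (differentiableAt_finiteTheta_mul_zpow N k (norm_ne_zero_iff.mp (by simp [hz]))).continuousAt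

lemma thetaCoeff_succ_index (hq0 : 0 < q) (hq1 : q < 1) (N : ℕ) (k : ℤ) :
    q ^ (2 * N) * ((q : ℂ) ^ 2) ^ (-k) * thetaCoeff q N k -
        ((q : ℂ) ^ 2) ^ (-k - 1) * thetaCoeff q N (k + 1) =
      thetaCoeff q N k - q ^ (2 * N) * thetaCoeff q N (k + 1) := by
  have hqc : (q : ℂ) ≠ 0 := by exact_mod_cast hq0.ne'
  have hq2 : (q : ℂ) ^ 2 ≠ 0 := pow_ne_zero 2 hqc
  have hshift : ∀ k : ℤ, circleAverage
      (fun z => finiteTheta q N ((q * z) ^ 2) * ((q * z) ^ 2) ^ k) 0 1 = thetaCoeff q N k := by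
    intro k
    rw [circleAverage_eq_of_differentiableAt_annulus
      (f := fun z => finiteTheta q N (z ^ 2) * (z ^ 2) ^ k) hq0 hq1.le fun z hz _ =>
        differentiableAt_finiteTheta_mul_zpow N k (norm_pos_iff.mp (hq0.trans_le hz))]
    simp [thetaCoeff]
  have hshiftInt : ∀ k : ℤ, CircleIntegrable
      (fun z => finiteTheta q N ((q * z) ^ 2) * ((q * z) ^ 2) ^ k) 0 1 := fun k =>
    circleIntegrable_of_continuousAt fun z hz => by
      have hz0 : z ≠ 0 := norm_ne_zero_iff.mp (by simp [hz])
      exact ContinuousAt.comp' (g := fun z => finiteTheta q N (z ^ 2) * (z ^ 2) ^ k)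
        (differentiableAt_finiteTheta_mul_zpow N k (mul_ne_zero hqc hz0)).continuousAt (by fun_prop)
  have hint := circleIntegrable_finiteTheta (q := q) N
  have hL := circleAverage_lincomb (q ^ (2 * N) * ((q : ℂ) ^ 2) ^ (-k)) (((q : ℂ) ^ 2) ^ (-k - 1))
    (hshiftInt k) (hshiftInt (k + 1))
  have hR := circleAverage_lincomb 1 ((q : ℂ) ^ (2 * N)) (hint k) (hint (k + 1))
  rw [hshift, hshift] at hL
  rw [one_mul] at hR
  unfold thetaCoeff at hL ⊢
  rw [hL, hR]
  refine circleAverage_congr_sphere fun z hz => ?_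
  have hz0 : z ≠ 0 := by
    rintro rfl
    simp at hz
  have hz2 : z ^ 2 ≠ 0 := pow_ne_zero 2 hz0
  have h := finiteTheta_shift hq0 N hz2
  simp only [mul_pow, mul_zpow, zpow_add₀ hz2, zpow_add₀ hq2, zpow_sub₀ hq2, zpow_neg, zpow_one]
  have h1 : ((q : ℂ) ^ 2) ^ k ≠ 0 := zpow_ne_zero k hq2
  generalize ((q : ℂ) ^ 2) ^ k = Q at *
  generalize (z ^ 2) ^ k = Z at *
  field_simp
  linear_combination Z * h

end TotalMass

section TotalMassLimit

variable {q : ℝ}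

lemma one_sub_pow_ne_zero (hq0 : 0 < q) (hq1 : q < 1) {j : ℕ} (hj : j ≠ 0) :
    1 - (q : ℂ) ^ j ≠ 0 := by
  have h : q ^ j < 1 := pow_lt_one₀ hq0.le hq1 hj
  exact_mod_cast (sub_pos.mpr h).ne'

lemma thetaCoeff_one (hq0 : 0 < q) (hq1 : q < 1) (N : ℕ) :
    thetaCoeff q N 1 * (1 - q ^ (2 * N + 2)) = -q ^ 2 * (1 - q ^ (2 * N)) * thetaCoeff q N 0 := by
  have hqc : (q : ℂ) ≠ 0 := by exact_mod_cast hq0.ne'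
  have h := thetaCoeff_succ_index hq0 hq1 N 0
  simp only [neg_zero, zpow_zero, mul_one, zero_sub, zpow_neg, zpow_one, zero_add] at h
  field_simp at h
  linear_combination -h

lemma thetaCoeff_neg_one (hq0 : 0 < q) (hq1 : q < 1) (N : ℕ) :
    thetaCoeff q N (-1) * (1 - q ^ (2 * N + 2)) = -(1 - q ^ (2 * N)) * thetaCoeff q N 0 := by
  have h := thetaCoeff_succ_index hq0 hq1 N (-1)
  simp only [neg_neg, zpow_one, sub_self, zpow_zero, one_mul, neg_add_cancel] at h
  linear_combination -h

lemma thetaCoeff_succ_zero (N : ℕ) :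
    thetaCoeff q (N + 1) 0 = (1 + q ^ (4 * N + 2)) * thetaCoeff q N 0 -
      (q ^ (2 * N) * thetaCoeff q N 1 + q ^ (2 * N + 2) * thetaCoeff q N (-1)) := by
  have hint := circleIntegrable_finiteTheta (q := q) N
  have h1 := circleAverage_lincomb ((q : ℂ) ^ (2 * N)) (-q ^ (2 * N + 2)) (hint 1) (hint (-1))
  have hi1 : CircleIntegrable (fun z => (q : ℂ) ^ (2 * N) * (finiteTheta q N (z ^ 2) *
      (z ^ 2) ^ (1 : ℤ)) - (-q ^ (2 * N + 2)) * (finiteTheta q N (z ^ 2) *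
      (z ^ 2) ^ (-1 : ℤ))) 0 1 :=
    ((hint 1).const_smul (a := (q : ℂ) ^ (2 * N))).sub
      ((hint (-1)).const_smul (a := -(q : ℂ) ^ (2 * N + 2)))
  have h2 := circleAverage_lincomb (1 + (q : ℂ) ^ (4 * N + 2)) 1 (hint 0) hi1
  rw [← h1] at h2
  unfold thetaCoeff
  rw [one_mul, neg_mul, sub_neg_eq_add] at h2
  rw [h2]
  refine circleAverage_congr_sphere fun z hz => ?_
  have hz0 : z ≠ 0 := by
    rintro rfl
    simp at hz
  simp only [finiteTheta_succ, zpow_zero, zpow_neg, zpow_one]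
  field_simp
  ring

lemma thetaCoeff_zero (hq0 : 0 < q) (hq1 : q < 1) (N : ℕ) :
    thetaCoeff q N 0 * qpochC q (q ^ 2) N ^ 2 = qpochC q (q ^ 2) (2 * N) := by
  induction N with
  | zero => simp [thetaCoeff, finiteTheta, qpochC_zero, circleAverage_const]
  | succ N ih =>
    have e : 2 * (N + 1) = 2 * N + 1 + 1 := by ring
    rw [e, qpochC_succ _ N, qpochC_succ _ (2 * N + 1), qpochC_succ _ (2 * N), ← ih,
      thetaCoeff_succ_zero]
    have h1 := thetaCoeff_one hq0 hq1 N
    have h2 := thetaCoeff_neg_one hq0 hq1 N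
    have hP := one_sub_pow_ne_zero hq0 hq1 (j := 2 * N + 2) (by omega)
    have p1 : (q : ℂ) ^ (2 * N + 2) = q ^ 2 * q ^ (2 * N) := by ring
    have p2 : (q : ℂ) ^ (4 * N + 2) = q ^ 2 * (q ^ (2 * N)) ^ 2 := by ring
    have p3 : (q : ℂ) ^ (2 * (2 * N)) = (q ^ (2 * N)) ^ 2 := by ring
    have p4 : (q : ℂ) ^ (2 * (2 * N + 1)) = q ^ 2 * (q ^ (2 * N)) ^ 2 := by ring
    rw [p1] at h1 h2 hP
    rw [p1, p2, p3, p4]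
    generalize (q : ℂ) ^ (2 * N) = P at *
    generalize thetaCoeff q N 1 = e1 at *
    generalize thetaCoeff q N (-1) = e2 at *
    generalize thetaCoeff q N 0 = e0 at *
    generalize qpochC q (q ^ 2) N = Y at *
    linear_combination (-P * h1 - q ^ 2 * P * h2) * Y ^ 2 * (1 - q ^ 2 * P)

lemma circleAverage_qpochC_mul (hq0 : 0 < q) (hq1 : q < 1) (N : ℕ) :
    circleAverage (fun z => qpochC q (z ^ 2) N * qpochC q ((z⁻¹) ^ 2) (N + 1)) 0 1 *
        (qpochC q (q ^ 2) N ^ 2 * (1 - q ^ (2 * N + 2))) =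
      qpochC q (q ^ 2) (2 * N) * (2 - q ^ (2 * N) - q ^ (2 * N + 2)) := by
  have hint := circleIntegrable_finiteTheta (q := q) N
  have h1 := circleAverage_lincomb 1 1 (hint 0) (hint (-1))
  have h2 : circleAverage (fun z => qpochC q (z ^ 2) N * qpochC q ((z⁻¹) ^ 2) (N + 1)) 0 1 =
      thetaCoeff q N 0 - thetaCoeff q N (-1) := by
    rw [one_mul, one_mul] at h1
    unfold thetaCoeff
    rw [h1]
    refine circleAverage_congr_sphere fun z hz => ?_
    simp only [finiteTheta, qpochC_succ', zpow_zero, zpow_neg, zpow_one, inv_pow,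
      mul_comm ((q : ℂ) ^ 2)]
    ring
  rw [h2, ← thetaCoeff_zero hq0 hq1]
  linear_combination -thetaCoeff_neg_one hq0 hq1 N * qpochC q (q ^ 2) N ^ 2

lemma circleAverage_qpochCInf_mul (hq0 : 0 < q) (hq1 : q < 1) :
    qpochCInf q (q ^ 2) *
      circleAverage (fun z => qpochCInf q (z ^ 2) * qpochCInf q ((z⁻¹) ^ 2)) 0 1 = 2 := by
  set A := circleAverage (fun z => qpochCInf q (z ^ 2) * qpochCInf q ((z⁻¹) ^ 2)) 0 1
  set S := ∑' j : ℕ, ‖-((q : ℂ) ^ (2 * j))‖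
  have hS : ∀ N : ℕ, ∀ w : ℂ, ‖w‖ = 1 → ‖qpochC q w N‖ ≤ Real.exp S := fun N w hw => by
    simpa only [hw, one_mul] using norm_qpochC_le hq0 hq1 w N
  have hA : Tendsto (fun N => circleAverage
      (fun z => qpochC q (z ^ 2) N * qpochC q ((z⁻¹) ^ 2) (N + 1)) 0 1) atTop (𝓝 A) := by
    refine tendsto_circleAverage_of_dominated (g := fun _ => Real.exp S * Real.exp S)
      (fun N z hz => ?_) (circleIntegrable_const _ _ _) (fun N z hz => ?_) (fun z hz => ?_)
    · have hz0 : z ≠ 0 := norm_ne_zero_iff.mp (by simp [hz])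
      have hinv : ContinuousAt (fun z : ℂ => z⁻¹) z := continuousAt_inv₀ hz0
      exact ((continuous_qpochC _).continuousAt.comp' (by fun_prop)).mul
        ((continuous_qpochC _).continuousAt.comp' (by fun_prop))
    · have h1 := hS N (z ^ 2) (by simp [hz])
      have h2 := hS (N + 1) ((z⁻¹) ^ 2) (by simp [hz])
      rw [norm_mul]
      gcongr
    · exact (tendsto_qpochC hq0 hq1 _).mul
        ((tendsto_qpochC hq0 hq1 _).comp (tendsto_add_atTop_nat 1))
  have hpow : Tendsto (fun N : ℕ => (q : ℂ) ^ (2 * N)) atTop (𝓝 0) := by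
    simp only [pow_mul]
    exact tendsto_pow_atTop_nhds_zero_of_norm_lt_one (norm_ofReal_sq_lt_one hq0 hq1)
  have hpow' : Tendsto (fun N : ℕ => (q : ℂ) ^ (2 * N + 2)) atTop (𝓝 0) := by
    simpa [pow_add] using hpow.mul_const ((q : ℂ) ^ 2)
  have hY := tendsto_qpochC hq0 hq1 ((q : ℂ) ^ 2)
  have hL := hA.mul ((hY.pow 2).mul (hpow'.const_sub 1))
  have hR := (hY.comp (tendsto_id.const_mul_atTop' (two_pos : 0 < 2))).mul
    ((hpow.const_sub 2).sub hpow')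
  have h := tendsto_nhds_unique (hL.congr fun N => circleAverage_qpochC_mul hq0 hq1 N) hR
  have hne := qpochCInf_ne_zero hq0 hq1 (norm_ofReal_sq_lt_one hq0 hq1)
  apply mul_left_cancel₀ hne
  linear_combination h

lemma circleAverage_ascWeight (hq0 : 0 < q) (hq1 : q < 1) {a b : ℂ} (ha : ‖a‖ < 1)
    (hb : ‖b‖ < 1) :
    qpochCInf q (q ^ 2) * qpochCInf q (a * b) * circleAverage (ascWeight q a b) 0 1 = 2 := by
  rw [mul_assoc, circleAverage_ascWeight_mul_qpochCInf hq0 hq1 ha hb,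
    circleAverage_qpochCInf_mul hq0 hq1]

end TotalMassLimit

section ChuVandermonde

variable {q : ℝ}

/-- The coefficient `(q^{-2k}; q²)_l q^{2l} / (q²; q²)_l` of a terminating q-hypergeometric sum. -/
noncomputable def termCoeff (q : ℝ) (k l : ℕ) : ℂ :=
  qpochC q (((q : ℂ) ^ (2 * k))⁻¹) l / qpochC q ((q : ℂ) ^ 2) l * (q : ℂ) ^ (2 * l)

lemma termCoeff_zero_right (k : ℕ) : termCoeff q k 0 = 1 := by
  simp [termCoeff, qpochC_zero]

lemma termCoeff_self_succ (hq0 : 0 < q) (k : ℕ) : termCoeff q k (k + 1) = 0 := by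
  have hqc : (q : ℂ) ≠ 0 := by exact_mod_cast hq0.ne'
  rw [termCoeff, qpochC_succ, inv_mul_cancel₀ (pow_ne_zero _ hqc)]
  simp

lemma termCoeff_succ_succ (hq0 : 0 < q) (hq1 : q < 1) (k l : ℕ) :
    termCoeff q (k + 1) (l + 1) =
      ((q : ℂ) ^ (2 * (l + 1)))⁻¹ * termCoeff q k (l + 1) -
        ((q : ℂ) ^ (2 * l))⁻¹ * termCoeff q k l := by
  have hqc : (q : ℂ) ≠ 0 := by exact_mod_cast hq0.ne'
  have hY := qpochC_ne_zero hq0 hq1 (norm_ofReal_sq_lt_one hq0 hq1) l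
  have hl := one_sub_mul_pow_ne_zero hq0 hq1 (norm_ofReal_sq_lt_one hq0 hq1) (2 * l)
  have e : ((q : ℂ) ^ (2 * (k + 1)))⁻¹ * q ^ 2 = ((q : ℂ) ^ (2 * k))⁻¹ := by
    field_simp
    ring
  simp only [termCoeff]
  rw [qpochC_succ' (((q : ℂ) ^ (2 * (k + 1)))⁻¹), e, qpochC_succ, qpochC_succ, mul_add, mul_add,
    pow_add, pow_add]
  have hk : (q : ℂ) ^ (2 * k) ≠ 0 := pow_ne_zero _ hqc
  have hl' : (q : ℂ) ^ (2 * l) ≠ 0 := pow_ne_zero _ hqc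
  generalize (q : ℂ) ^ (2 * k) = K at *
  generalize (q : ℂ) ^ (2 * l) = L at *
  generalize qpochC q (K⁻¹) l = X
  generalize qpochC q (q ^ 2) l = Y at *
  field_simp
  ring

lemma sum_termCoeff_succ (hq0 : 0 < q) (hq1 : q < 1) (k : ℕ) (u : ℕ → ℂ) :
    ∑ l ∈ Finset.range (k + 2), termCoeff q (k + 1) l * u l =
      ∑ l ∈ Finset.range (k + 1),
        termCoeff q k l * (((q : ℂ) ^ (2 * l))⁻¹ * (u l - u (l + 1))) := by
  have h : ∀ l, termCoeff q (k + 1) (l + 1) * u (l + 1) =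
      ((q : ℂ) ^ (2 * (l + 1)))⁻¹ * termCoeff q k (l + 1) * u (l + 1) -
        ((q : ℂ) ^ (2 * l))⁻¹ * termCoeff q k l * u (l + 1) := fun l => by
    rw [termCoeff_succ_succ hq0 hq1]
    ring
  rw [Finset.sum_range_succ']
  simp only [h, Finset.sum_sub_distrib]
  rw [sub_add_eq_add_sub, termCoeff_zero_right, ← termCoeff_zero_right (q := q) k]
  have h2 := Finset.sum_range_succ'
    (fun l => ((q : ℂ) ^ (2 * l))⁻¹ * termCoeff q k l * u l) (k + 1)
  rw [Finset.sum_range_succ, termCoeff_self_succ hq0] at h2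
  simp only [mul_zero, zero_mul, add_zero, pow_zero, inv_one, one_mul] at h2
  rw [← h2, ← Finset.sum_sub_distrib]
  exact Finset.sum_congr rfl fun l _ => by ring

lemma q_chuVandermonde (hq0 : 0 < q) (hq1 : q < 1) (b : ℂ) {c : ℂ} (hc : ‖c‖ < 1) (k : ℕ) :
    ∑ l ∈ Finset.range (k + 1), termCoeff q k l * (qpochC q b l / qpochC q c l) =
      (∏ i ∈ Finset.range k, (b - c * q ^ (2 * i))) / qpochC q c k := by
  have hqc : (q : ℂ) ≠ 0 := by exact_mod_cast hq0.ne'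
  induction k generalizing c with
  | zero => simp [termCoeff_zero_right, qpochC_zero]
  | succ k ih =>
    have hc' := norm_mul_pow_lt_one hq0 hq1 hc 2
    have h1 : 1 - c ≠ 0 := by simpa using one_sub_mul_pow_ne_zero hq0 hq1 hc 0
    have hu : ∀ l : ℕ, ((q : ℂ) ^ (2 * l))⁻¹ *
        (qpochC q b l / qpochC q c l - qpochC q b (l + 1) / qpochC q c (l + 1)) =
        (b - c) / (1 - c) * (qpochC q b l / qpochC q (c * q ^ 2) l) := fun l => by
      have hL : (q : ℂ) ^ (2 * l) ≠ 0 := pow_ne_zero _ hqc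
      have h2 := qpochC_ne_zero hq0 hq1 hc l
      have h3 := qpochC_ne_zero hq0 hq1 hc' l
      have h4 := one_sub_mul_pow_ne_zero hq0 hq1 hc (2 * l)
      have e := (qpochC_succ' c l).symm.trans (qpochC_succ (q := q) c l)
      rw [qpochC_succ, qpochC_succ c, ← e]
      generalize (q : ℂ) ^ (2 * l) = L at *
      field_simp
      linear_combination qpochC q b l * e
    rw [sum_termCoeff_succ hq0 hq1]
    simp only [hu, mul_left_comm _ ((b - c) / (1 - c)), ← Finset.mul_sum]
    rw [ih hc', Finset.prod_range_succ', qpochC_succ', div_mul_div_comm]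
    congr 1
    simp only [mul_zero, pow_zero, mul_one]
    rw [mul_comm]
    congr 1
    exact Finset.prod_congr rfl fun i _ => by ring

lemma termCoeff_self_mul_prod (hq0 : 0 < q) (hq1 : q < 1) (m : ℕ) :
    termCoeff q m m * ∏ i ∈ Finset.range m, ((q : ℂ) ^ (2 * m) - q ^ (2 * i)) =
      qpochC q ((q : ℂ) ^ 2) m := by
  have hqc : (q : ℂ) ≠ 0 := by exact_mod_cast hq0.ne'
  induction m with
  | zero => simp [termCoeff_zero_right, qpochC_zero]
  | succ m ih =>
    have hprod : ∏ i ∈ Finset.range m, ((q : ℂ) ^ (2 * (m + 1)) - q ^ (2 * (i + 1))) =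
        q ^ (2 * m) * ∏ i ∈ Finset.range m, ((q : ℂ) ^ (2 * m) - q ^ (2 * i)) := by
      have : (q : ℂ) ^ (2 * m) = ∏ i ∈ Finset.range m, (q : ℂ) ^ 2 := by simp [pow_mul]
      rw [this, ← Finset.prod_mul_distrib]
      exact Finset.prod_congr rfl fun i _ => by rw [← this]; ring
    rw [termCoeff_succ_succ hq0 hq1, termCoeff_self_succ hq0, Finset.prod_range_succ', hprod,
      qpochC_succ, ← ih]
    have hL : (q : ℂ) ^ (2 * m) ≠ 0 := pow_ne_zero _ hqc
    field_simp
    ring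

end ChuVandermonde

section Orthogonality

variable {q : ℝ}

/-- The Al-Salam–Chihara form of the q-spherical function, where `z = q^{iρ}` and `a = q^n`. -/
noncomputable def sphPoly (q : ℝ) (a : ℂ) (m : ℕ) (z : ℂ) : ℂ :=
  ∑ l ∈ Finset.range (m + 1),
    termCoeff q m l / qpochC q (a * a) l * (qpochC q (a * z) l * qpochC q (a * z⁻¹) l)

lemma norm_mul_self_lt_one {a : ℂ} (ha : ‖a‖ < 1) : ‖a * a‖ < 1 := by
  rw [norm_mul]
  exact mul_lt_one_of_nonneg_of_lt_one_left (norm_nonneg a) ha ha.le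

lemma circleAverage_sphPoly_mul (hq0 : 0 < q) (hq1 : q < 1) {a : ℂ} (ha : ‖a‖ < 1) (m k : ℕ) :
    circleAverage (fun z => sphPoly q a m z * sphPoly q a k z * ascWeight q a a z) 0 1 =
      (∑ j ∈ Finset.range (m + 1), termCoeff q m j *
        ∏ i ∈ Finset.range k, (a * a * q ^ (2 * j) - a * a * q ^ (2 * i))) / qpochC q (a * a) k *
      circleAverage (ascWeight q a a) 0 1 := by
  have hA := norm_mul_self_lt_one ha
  have hexp : circleAverage (fun z => sphPoly q a m z * sphPoly q a k z * ascWeight q a a z) 0 1 =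
      circleAverage (fun z => ∑ j ∈ Finset.range (m + 1), ∑ l ∈ Finset.range (k + 1),
        (termCoeff q m j / qpochC q (a * a) j * (termCoeff q k l / qpochC q (a * a) l)) •
          ascWeight q (a * q ^ (2 * j)) (a * q ^ (2 * l)) z) 0 1 := by
    refine circleAverage_congr_sphere fun z hz => ?_
    have hz1 : ‖z‖ = 1 := by simpa using hz
    rw [sphPoly, sphPoly, Finset.sum_mul_sum, Finset.sum_mul]
    simp only [Finset.sum_mul, smul_eq_mul]
    refine Finset.sum_congr rfl fun j _ => Finset.sum_congr rfl fun l _ => ?_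
    rw [ascWeight_mul_qpochC hq0 hq1 ha hz1, ascWeight_comm a (a * _),
      ascWeight_mul_qpochC hq0 hq1 ha hz1]
    ring
  have hint : ∀ j l : ℕ, CircleIntegrable
      (ascWeight q (a * q ^ (2 * j)) (a * q ^ (2 * l))) 0 1 := fun j l =>
    circleIntegrable_of_continuousAt fun z hz => continuousAt_ascWeight hq0 hq1
      (norm_mul_pow_lt_one hq0 hq1 ha _) (norm_mul_pow_lt_one hq0 hq1 ha _) hz
  have hintS : ∀ (c : ℂ) (j l : ℕ), CircleIntegrable
      (fun z => c • ascWeight q (a * q ^ (2 * j)) (a * q ^ (2 * l)) z) 0 1 := fun c j l =>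
    (hint j l).const_smul
  rw [hexp, circleAverage_fun_sum fun j _ => CircleIntegrable.fun_sum _ fun l _ => hintS _ j l,
    Finset.sum_div, Finset.sum_mul]
  refine Finset.sum_congr rfl fun j _ => ?_
  rw [circleAverage_fun_sum fun l _ => hintS _ j l]
  simp only [circleAverage_fun_smul, circleAverage_ascWeight_shift_shift hq0 hq1 ha ha]
  rw [mul_div_assoc, ← q_chuVandermonde hq0 hq1 _ hA, Finset.mul_sum, Finset.sum_mul]
  refine Finset.sum_congr rfl fun l _ => ?_
  have h1 := qpochC_ne_zero hq0 hq1 hA j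
  have h2 := qpochC_ne_zero hq0 hq1 hA l
  rw [qpochC_add, smul_eq_mul]
  generalize qpochC q (a * a) j = X at *
  generalize qpochC q (a * a) l = Y at *
  field_simp

lemma circleAverage_sphPoly_mul_of_lt (hq0 : 0 < q) (hq1 : q < 1) {a : ℂ} (ha : ‖a‖ < 1)
    {m k : ℕ} (hmk : m < k) :
    circleAverage (fun z => sphPoly q a m z * sphPoly q a k z * ascWeight q a a z) 0 1 = 0 := by
  rw [circleAverage_sphPoly_mul hq0 hq1 ha, Finset.sum_eq_zero, zero_div, zero_mul]
  intro j hj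
  rw [Finset.prod_eq_zero (i := j), mul_zero]
  · exact Finset.mem_range.mpr (by have := Finset.mem_range.mp hj; omega)
  · exact sub_self _

lemma circleAverage_sphPoly_mul_of_ne (hq0 : 0 < q) (hq1 : q < 1) {a : ℂ} (ha : ‖a‖ < 1)
    {m k : ℕ} (hmk : m ≠ k) :
    circleAverage (fun z => sphPoly q a m z * sphPoly q a k z * ascWeight q a a z) 0 1 = 0 := by
  rcases hmk.lt_or_gt with h | h
  · exact circleAverage_sphPoly_mul_of_lt hq0 hq1 ha h
  · simpa only [mul_comm] using circleAverage_sphPoly_mul_of_lt hq0 hq1 ha h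

lemma circleAverage_sphPoly_sq (hq0 : 0 < q) (hq1 : q < 1) {a : ℂ} (ha : ‖a‖ < 1) (m : ℕ) :
    circleAverage (fun z => sphPoly q a m z * sphPoly q a m z * ascWeight q a a z) 0 1 =
      (a * a) ^ m * qpochC q (q ^ 2) m / qpochC q (a * a) m *
        circleAverage (ascWeight q a a) 0 1 := by
  rw [circleAverage_sphPoly_mul hq0 hq1 ha, Finset.sum_range_succ, Finset.sum_eq_zero, zero_add]
  · simp only [← mul_sub, Finset.prod_mul_distrib, Finset.prod_const, Finset.card_range]
    rw [mul_left_comm, termCoeff_self_mul_prod hq0 hq1, mul_pow]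
  · intro j hj
    rw [Finset.prod_eq_zero hj (sub_self _), mul_zero]

lemma qpochCInf_mul_circleAverage_sphPoly_sq (hq0 : 0 < q) (hq1 : q < 1) {n : ℕ} (hn : 1 ≤ n)
    (m : ℕ) :
    qpochCInf q (q ^ (2 * n)) ^ 2 * circleAverage (fun z =>
        sphPoly q (q ^ n) m z * sphPoly q (q ^ n) m z * ascWeight q (q ^ n) (q ^ n) z) 0 1 *
      qpochC q (q ^ (2 * m + 2)) (n - 1) = 2 * q ^ (2 * n * m) := by
  have ha : ‖(q : ℂ) ^ n‖ < 1 := by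
    rw [norm_pow, Complex.norm_real, Real.norm_of_nonneg hq0.le]
    exact pow_lt_one₀ hq0.le hq1 (by omega)
  have hA := norm_mul_self_lt_one ha
  have hp := norm_ofReal_sq_lt_one hq0 hq1
  have hM := circleAverage_ascWeight hq0 hq1 ha ha
  have eA : (q : ℂ) ^ n * q ^ n = q ^ (2 * n) := by ring
  rw [circleAverage_sphPoly_sq hq0 hq1 ha]
  rw [eA] at hM hA ⊢
  have h1 := qpochCInf_eq_qpochC_mul hq0 hq1 ((q : ℂ) ^ (2 * n)) m
  have h2 := qpochCInf_eq_qpochC_mul hq0 hq1 ((q : ℂ) ^ 2) (m + (n - 1))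
  have e2 : (q : ℂ) ^ 2 * q ^ (2 * (m + (n - 1))) = q ^ (2 * n) * q ^ (2 * m) := by
    rw [← pow_add, ← pow_add]
    congr 1
    omega
  have e3 : (q : ℂ) ^ 2 * q ^ (2 * m) = q ^ (2 * m + 2) := by ring
  rw [e2, qpochC_add, e3] at h2
  have hne1 := qpochC_ne_zero hq0 hq1 hA m
  have hne2 := qpochCInf_ne_zero hq0 hq1 (norm_mul_pow_lt_one hq0 hq1 hA (2 * m))
  have e4 : ((q : ℂ) ^ (2 * n)) ^ m = q ^ (2 * n * m) := (pow_mul _ _ _).symm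
  rw [e4]
  rw [h2] at hM
  rw [h1] at hM ⊢
  field_simp
  linear_combination (q : ℂ) ^ (2 * n * m) * hM

end Orthogonality

section Inversion

variable {q : ℝ}

lemma sphPoly_inv (a : ℂ) (m : ℕ) (z : ℂ) : sphPoly q a m z⁻¹ = sphPoly q a m z := by
  simp only [sphPoly, inv_inv, mul_comm (qpochC q (a * z) _)]

lemma ascWeight_inv (a b z : ℂ) : ascWeight q a b z⁻¹ = ascWeight q a b z := by
  simp only [ascWeight, inv_inv, mul_comm (qpochCInf q (a * z)), mul_comm (qpochCInf q (b * z)),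
    mul_comm (qpochCInf q (z ^ 2))]

lemma continuousAt_sphPoly (a : ℂ) (m : ℕ) {z : ℂ} (hz : z ≠ 0) :
    ContinuousAt (sphPoly q a m) z := by
  have hinv : ContinuousAt (fun z : ℂ => z⁻¹) z := continuousAt_inv₀ hz
  have hc := fun l => (continuous_qpochC (q := q) l)
  refine tendsto_finsetSum _ fun l _ => ContinuousAt.mul continuousAt_const (ContinuousAt.mul ?_ ?_)
  · exact (hc l).continuousAt.comp' (by fun_prop)
  · exact (hc l).continuousAt.comp' (by fun_prop)

lemma qcpow_add (x y : ℂ) : qcpow q (x + y) = qcpow q x * qcpow q y := by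
  rw [qcpow, qcpow, qcpow, add_mul, Complex.exp_add]

lemma qcpow_neg (x : ℂ) : qcpow q (-x) = (qcpow q x)⁻¹ := by
  rw [qcpow, qcpow, neg_mul, Complex.exp_neg]

lemma qcpow_natCast (hq0 : 0 < q) (n : ℕ) : qcpow q n = (q : ℂ) ^ n := by
  rw [qcpow, Complex.exp_nat_mul, ← Complex.ofReal_exp, Real.exp_log hq0]

lemma sphPhi_eq_sphPoly (hq0 : 0 < q) (n : ℕ) (ρ : ℝ) (m : ℕ) :
    sphPhi q n ρ m = sphPoly q (q ^ n) m (qcpow q (ρ * Complex.I)) := by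
  refine Finset.sum_congr rfl fun l _ => ?_
  rw [sub_eq_add_neg, qcpow_add, qcpow_add, qcpow_neg, qcpow_natCast hq0, termCoeff, ← pow_add,
    ← two_mul]
  simp only [div_eq_mul_inv, mul_inv]
  ring

lemma cInv_eq_ascWeight (hq0 : 0 < q) (n : ℕ) (ρ : ℝ) :
    cInv q n ρ = qpochCInf q (q ^ (2 * n)) ^ 2 *
      ascWeight q (q ^ n) (q ^ n) (qcpow q (ρ * Complex.I)) := by
  have e : 2 * (ρ : ℂ) * Complex.I = ρ * Complex.I + ρ * Complex.I := by ring
  rw [cInv, ascWeight, sub_eq_add_neg, e, qcpow_neg, qcpow_add, qcpow_add, qcpow_add, qcpow_neg,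
    qcpow_natCast hq0, ← pow_two, ← inv_pow, mul_assoc, mul_div_assoc, ← mul_pow, ← pow_two]

lemma integral_eq_circleAverage {G : ℂ → ℂ} (hG : ∀ z : ℂ, ‖z‖ = 1 → ContinuousAt G z)
    (hsymm : ∀ z, G z⁻¹ = G z) :
    ∫ θ in (0 : ℝ)..π, G (circleMap 0 1 θ) = π * circleAverage G 0 1 := by
  have hint := circleIntegrable_of_continuousAt hG
  have hper : Function.Periodic (fun θ => G (circleMap 0 1 θ)) (2 * π) := fun θ => by
    simp only [periodic_circleMap 0 1 θ]
  have hI : ∀ a b : ℝ, IntervalIntegrable (fun θ => G (circleMap 0 1 θ)) MeasureTheory.volume a b :=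
    fun a b => Continuous.intervalIntegrable (continuous_iff_continuousAt.mpr fun θ =>
      (hG _ (by simp)).comp' (continuous_circleMap 0 1).continuousAt) a b
  have hrefl : ∫ θ in π..(2 * π), G (circleMap 0 1 θ) = ∫ θ in (0 : ℝ)..π, G (circleMap 0 1 θ) := by
    have h := intervalIntegral.integral_comp_sub_left (a := 0) (b := π)
      (fun θ => G (circleMap 0 1 θ)) (2 * π)
    rw [sub_zero, two_mul, add_sub_cancel_right, ← two_mul] at h
    rw [← h]
    refine intervalIntegral.integral_congr fun θ _ => ?_
    have e : (circleMap 0 1 (-θ) : ℂ) = (circleMap 0 1 θ)⁻¹ := by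
      simp [circleMap, Complex.exp_neg]
    have := hper (-θ)
    simp only at this ⊢
    rw [show 2 * π - θ = -θ + 2 * π by ring, this, e, hsymm]
  have hadd := intervalIntegral.integral_add_adjacent_intervals (hI 0 π) (hI π (2 * π))
  rw [hrefl, ← two_mul] at hadd
  rw [circleAverage_def, ← hadd]
  have hpi : (π : ℂ) ≠ 0 := by exact_mod_cast Real.pi_ne_zero
  simp only [Complex.real_smul]
  push_cast
  field_simp

lemma integral_qcpow_eq_circleAverage (hq0 : 0 < q) (hq1 : q < 1) {G : ℂ → ℂ}
    (hG : ∀ z : ℂ, ‖z‖ = 1 → ContinuousAt G z) (hsymm : ∀ z, G z⁻¹ = G z) :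
    ∫ ρ in (0 : ℝ)..(2 * π / Real.log ((q ^ 2)⁻¹)), G (qcpow q (ρ * Complex.I)) =
      (2 * π / Real.log ((q ^ 2)⁻¹) : ℝ) * circleAverage G 0 1 := by
  have hlog : Real.log q < 0 := Real.log_neg hq0 hq1
  have hh : Real.log ((q ^ 2)⁻¹) = 2 * -Real.log q := by
    rw [Real.log_inv, Real.log_pow]
    push_cast
    ring
  have hc : -Real.log q ≠ 0 := neg_ne_zero.mpr hlog.ne
  have hfun : ∀ ρ : ℝ, G (qcpow q (ρ * Complex.I)) = G (circleMap 0 1 (-Real.log q * ρ)) := by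
    intro ρ
    rw [← hsymm, ← qcpow_neg, qcpow, circleMap]
    congr 1
    push_cast
    rw [zero_add, one_mul]
    congr 1
    ring
  simp only [hfun]
  rw [intervalIntegral.integral_comp_mul_left (fun θ => G (circleMap 0 1 θ)) hc, hh, mul_zero,
    mul_div_mul_left _ _ two_ne_zero, mul_div_cancel₀ _ hc, integral_eq_circleAverage hG hsymm,
    Complex.real_smul]
  push_cast
  ring

end Inversion

/-- The inversion formula for the q-spherical transform: for finitely supported `f`,
`f(q^{2m}) = [h/(4π(1−q^{2n}))] ∫_0^{2π/h} 𝓕f(ρ) φ_ρ(q^{2m}) dρ/|c(ρ)|²`,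
where `h = log q^{−2}`. -/
theorem statement6 (q : ℝ) (hq0 : 0 < q) (hq1 : q < 1) (n : ℕ) (hn : 1 ≤ n)
    (f : ℕ → ℂ) (hf : (Function.support f).Finite) (m : ℕ) :
    f m = ((Real.log ((q ^ 2)⁻¹) / (4 * Real.pi * (1 - q ^ (2 * n))) : ℝ) : ℂ) *
      ∫ ρ in (0 : ℝ)..(2 * Real.pi / Real.log ((q ^ 2)⁻¹)),
        sphT q n f ρ * sphPhi q n ρ m * cInv q n ρ := by
  have hqc : (q : ℂ) ≠ 0 := by exact_mod_cast hq0.ne'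
  have ha : ‖(q : ℂ) ^ n‖ < 1 := by
    rw [norm_pow, Complex.norm_real, Real.norm_of_nonneg hq0.le]
    exact pow_lt_one₀ hq0.le hq1 (by omega)
  set s : Finset ℕ := hf.toFinset with hs
  set c : ℕ → ℂ := fun k => (1 - (q : ℂ) ^ (2 * n)) * (f k * ((q : ℂ) ^ (2 * n * k))⁻¹ *
    qpochC q ((q : ℂ) ^ (2 * k + 2)) (n - 1)) * qpochCInf q (q ^ (2 * n)) ^ 2 with hc
  set F : ℕ → ℂ → ℂ := fun k z =>
    sphPoly q (q ^ n) k z * sphPoly q (q ^ n) m z * ascWeight q (q ^ n) (q ^ n) z with hF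
  have hFc : ∀ k, ∀ z : ℂ, ‖z‖ = 1 → ContinuousAt (F k) z := fun k z hz => by
    have hz0 : z ≠ 0 := norm_ne_zero_iff.mp (by simp [hz])
    exact ((continuousAt_sphPoly _ k hz0).mul (continuousAt_sphPoly _ m hz0)).mul
      (continuousAt_ascWeight hq0 hq1 ha ha hz)
  have hFint : ∀ k, CircleIntegrable (fun z => c k • F k z) 0 1 := fun k =>
    (circleIntegrable_of_continuousAt (hFc k)).const_smul
  have hintegrand : ∀ ρ : ℝ, sphT q n f ρ * sphPhi q n ρ m * cInv q n ρ =
      ∑ k ∈ s, c k • F k (qcpow q (ρ * Complex.I)) := fun ρ => by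
    rw [sphT, tsum_eq_sum (s := s), cInv_eq_ascWeight hq0, Finset.mul_sum, Finset.sum_mul,
      Finset.sum_mul]
    · refine Finset.sum_congr rfl fun k _ => ?_
      rw [sphPhi_eq_sphPoly hq0, sphPhi_eq_sphPoly hq0]
      simp only [hc, hF, smul_eq_mul]
      ring
    · intro k hk
      have : f k = 0 := by simpa [hs] using hk
      simp [this]
  simp only [hintegrand]
  rw [integral_qcpow_eq_circleAverage (G := fun z => ∑ k ∈ s, c k • F k z) hq0 hq1
    (fun z hz => tendsto_finsetSum _ fun k _ => (hFc k z hz).const_smul (c k))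
    (fun z => by simp only [hF, sphPoly_inv, ascWeight_inv]),
    circleAverage_fun_sum fun k _ => hFint k]
  have hsum : ∑ k ∈ s, circleAverage (fun z => c k • F k z) 0 1 =
      c m * circleAverage (F m) 0 1 := by
    simp only [circleAverage_fun_smul]
    rw [← smul_eq_mul]
    refine Finset.sum_eq_single m (fun k _ hk => ?_) fun hm => ?_
    · rw [circleAverage_sphPoly_mul_of_ne hq0 hq1 ha hk, smul_zero]
    · have : f m = 0 := by simpa [hs] using hm
      simp [hc, this]
  have hmass := qpochCInf_mul_circleAverage_sphPoly_sq hq0 hq1 hn m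
  have hlog : Real.log ((q ^ 2)⁻¹) ≠ 0 := by
    rw [Real.log_inv, Real.log_pow]
    simpa using ⟨hq0.ne', hq1.ne, by linarith⟩
  have hL : ((Real.log ((q ^ 2)⁻¹) : ℝ) : ℂ) ≠ 0 := by exact_mod_cast hlog
  have hpi : (π : ℂ) ≠ 0 := by exact_mod_cast Real.pi_ne_zero
  have h1 := one_sub_pow_ne_zero hq0 hq1 (j := 2 * n) (by omega)
  have h2 : (q : ℂ) ^ (2 * n * m) ≠ 0 := pow_ne_zero _ hqc
  rw [hsum]
  change _ ^ 2 * circleAverage (F m) 0 1 * _ = _ at hmass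
  simp only [hc, Complex.ofReal_div, Complex.ofReal_mul, Complex.ofReal_sub, Complex.ofReal_pow,
    Complex.ofReal_one, Complex.ofReal_ofNat]
  generalize ((Real.log ((q ^ 2)⁻¹) : ℝ) : ℂ) = L at *
  generalize circleAverage (F m) 0 1 = X at *
  generalize (q : ℂ) ^ (2 * n * m) = Q at *
  generalize qpochC q ((q : ℂ) ^ (2 * m + 2)) (n - 1) = Y at *
  generalize qpochCInf q ((q : ℂ) ^ (2 * n)) = Z at *
  generalize (q : ℂ) ^ (2 * n) = A at *
  field_simp
  linear_combination -2 * f m * hmass
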